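/- The lowering operator L_d, applied to an admissible triangle in which row d is a V-row of rank t and row d−1 is an X-row (of rank t+1), produces an admissible triangle in which the rank of row d−1 becomes t, and L_d preserves the weight of the triangle. -/

import Mathlib

open Finset
open scoped Classical

/-- Symbols occurring in a triangle: `x i`, `y i` (indices `1,...,n` encoded by `Fin n`),
`a i j`, `b i j` (the edge `{i+1,j+1}` oriented from smaller to larger, resp. larger to
smaller), and the numbers `1,...,n` of the bottom row. -/
inductive TSym (n : ℕ) where
  | x (i : Fin n)
  | y (i : Fin n)
  | a (i j : Fin n)
  | b (i j : Fin n)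
  | num (i : Fin n)
deriving DecidableEq

/-- A triangle of order `n`: row `r` (0-indexed) has `r+1` entries. -/
def Tri (n : ℕ) := ∀ r : Fin n, Fin (r.val + 1) → TSym n

namespace TSym

variable {n : ℕ}

/-- The symbol lies in `𝒳`. -/
def isX : TSym n → Prop
  | .x _ => True
  | .y _ => True
  | _ => False

/-- The symbol lies in `𝒱_k`. -/
def isV (k : ℕ) : TSym n → Prop
  | .a i j => j.val = i.val + k ∧ 0 < k
  | .b i j => j.val = i.val + k ∧ 0 < k
  | _ => False

/-- Well-formedness of a non-bottom entry: `a i j` and `b i j` require `i < j`;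
numbers may not occur. -/
def wf : TSym n → Prop
  | .a i j => i < j
  | .b i j => i < j
  | .num _ => False
  | _ => True

/-- The left value of a symbol lying in a row of rank `t` (values are `1`-based). -/
def lval (t : ℕ) : TSym n → ℤ
  | .x i => (i.val : ℤ) + 1
  | .y j => (j.val : ℤ) + 1 - t
  | .a i _ => (i.val : ℤ) + 1
  | .b i _ => (i.val : ℤ) + 1
  | .num i => (i.val : ℤ) + 1

/-- The right value of a symbol lying in a row of rank `t`. -/
def rval (t : ℕ) : TSym n → ℤ
  | .x i => (i.val : ℤ) + 1 + t
  | .y j => (j.val : ℤ) + 1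
  | .a _ j => (j.val : ℤ) + 1
  | .b _ j => (j.val : ℤ) + 1
  | .num i => (i.val : ℤ) + 1

end TSym

variable {n : ℕ}

/-- Row `r` is an `𝒳`-row. -/
def IsXRow (t : Tri n) (r : Fin n) : Prop := ∀ i, (t r i).isX

/-- Row `r` has all entries in `𝒱_k`. -/
def IsVRowOf (t : Tri n) (r : Fin n) (k : ℕ) : Prop := ∀ i, (t r i).isV k

/-- Row `r` is a `𝒱`-row. -/
def IsVRow (t : Tri n) (r : Fin n) : Prop := ∃ k, IsVRowOf t r k

/-- The bottom row is `(1,2,...,n)`. -/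
def BottomOK (t : Tri n) : Prop :=
  ∀ (r : Fin n), r.val = n - 1 → ∀ i : Fin (r.val + 1),
    t r i = .num ⟨i.val, by have := i.isLt; have := r.isLt; omega⟩

/-- All non-bottom entries are well-formed. -/
def WellFormed (t : Tri n) : Prop :=
  ∀ r : Fin n, r.val < n - 1 → ∀ i, (t r i).wf

/-- `rk m` is the rank of (1-based) row `m`, for `0 ≤ m ≤ n`; Lean row index `r`
corresponds to row `r+1`.  An admissible ranking: the bottom row has rank `0`,
row `n-1` has rank `1`, and going up, an `𝒳`-row keeps the rank while a row whose
entries lie in `𝒱_k` has rank `k` and raises the rank above it to `k+1`. -/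
def IsRanking (t : Tri n) (rk : ℕ → ℕ) : Prop :=
  rk n = 0 ∧ (1 ≤ n → rk (n - 1) = 1) ∧
  ∀ r : Fin n, r.val < n - 1 →
    (IsXRow t r ∧ rk r.val = rk (r.val + 1)) ∨
    (IsVRowOf t r (rk (r.val + 1)) ∧ rk r.val = rk (r.val + 1) + 1)

/-- The monotone diagonal and monotone row properties: for every local arrangement
`v` directly above consecutive entries `u, w`, we require `l(u) ≤ l(v)` (strict when
`u` is a `y`), `r(v) ≤ r(w)` (strict when `w` is an `x`), and `l(u) < l(w)`. -/
def MonoProps (t : Tri n) (rk : ℕ → ℕ) : Prop :=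
  ∀ (r : Fin n) (hr : 1 ≤ r.val) (p : ℕ) (hp : p + 1 < r.val + 1),
    let u := t r ⟨p, by omega⟩
    let w := t r ⟨p + 1, by omega⟩
    let v := t ⟨r.val - 1, by have := r.isLt; omega⟩ ⟨p, by simp only [Fin.val_mk]; omega⟩
    (u.lval (rk (r.val + 1)) ≤ v.lval (rk r.val)) ∧
    ((∃ j, u = .y j) → u.lval (rk (r.val + 1)) < v.lval (rk r.val)) ∧
    (v.rval (rk r.val) ≤ w.rval (rk (r.val + 1))) ∧
    ((∃ j, w = .x j) → v.rval (rk r.val) < w.rval (rk (r.val + 1))) ∧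
    (u.lval (rk (r.val + 1)) < w.lval (rk (r.val + 1)))

/-- Admissibility of a triangle. -/
def IsAdmissible (t : Tri n) : Prop :=
  BottomOK t ∧ WellFormed t ∧ ∃ rk, IsRanking t rk ∧ MonoProps t rk

/-- The rank of the row with Lean index `r` (i.e. of row `r+1`), computed directly:
one more than the number of `𝒱`-rows strictly below it (above the bottom row). -/
noncomputable def rankOf (t : Tri n) (r : ℕ) : ℕ :=
  1 + ((univ : Finset (Fin n)).filter fun s => r < s.val ∧ IsVRow t s).card

open MvPolynomial in
/-- The weight of a symbol. -/
noncomputable def TSym.weight : TSym n → MvPolynomial (Fin n ⊕ Fin n) ℤ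
  | .x i => X (Sum.inl i)
  | .y j => X (Sum.inr j)
  | .a i _ => X (Sum.inl i)
  | .b _ j => X (Sum.inr j)
  | .num _ => 1

/-- The weight of a triangle: the product of the weights of its non-bottom entries. -/
noncomputable def weight (t : Tri n) : MvPolynomial (Fin n ⊕ Fin n) ℤ :=
  ∏ r : Fin n, if r.val < n - 1 then ∏ i, (t r i).weight else 1

/-- The raising operator `R_d` (`1 ≤ d < n`), acting on (paper-indexed) rows `d-1`
and `d`, i.e. Lean rows `d-2` and `d-1`. -/
noncomputable def Raise (d : ℕ) (t : Tri n) : Tri n := fun r i =>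
  if hu : 2 ≤ d ∧ r.val + 2 = d ∧ r.val + 1 < n then
    -- row d-1: swap with the entry diagonally below, else convert to an 𝒳-symbol
    match t r i with
    | .b j k =>
        if t ⟨r.val + 1, hu.2.2⟩ ⟨i.val, by have := i.isLt; simp only [Fin.val_mk]; omega⟩
            = .x j then .x j else .y k
    | .a j k =>
        if t ⟨r.val + 1, hu.2.2⟩ ⟨i.val + 1, by have := i.isLt; simp only [Fin.val_mk]; omega⟩
            = .y k then .y k else .x j
    | s => s
  else if hl : r.val + 1 = d then
    -- row d: swap with the entry diagonally above, else convert to a 𝒱-symbol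
    let tk := rankOf t r.val
    match t r i with
    | .x j =>
        if hi : i.val < r.val then
          match t ⟨r.val - 1, by have := r.isLt; omega⟩
              ⟨i.val, by simp only [Fin.val_mk]; omega⟩ with
          | .b j' k => if j' = j then .b j' k
              else if h2 : j.val + tk < n then .a j ⟨j.val + tk, h2⟩ else .x j
          | _ => if h2 : j.val + tk < n then .a j ⟨j.val + tk, h2⟩ else .x j
        else if h2 : j.val + tk < n then .a j ⟨j.val + tk, h2⟩ else .x j
    | .y k =>
        if hi : 1 ≤ i.val then
          match t ⟨r.val - 1, by have := r.isLt; omega⟩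
              ⟨i.val - 1, by have := i.isLt; simp only [Fin.val_mk]; omega⟩ with
          | .a j k' => if k' = k then .a j k'
              else if h2 : tk ≤ k.val then .b ⟨k.val - tk, by have := k.isLt; omega⟩ k
              else .y k
          | _ => if h2 : tk ≤ k.val then .b ⟨k.val - tk, by have := k.isLt; omega⟩ k
              else .y k
        else if h2 : tk ≤ k.val then .b ⟨k.val - tk, by have := k.isLt; omega⟩ k else .y k
    | s => s
  else t r i

/-- The lowering operator `L_d` (`1 ≤ d < n`), inverse to `R_d`. -/
noncomputable def Lower (d : ℕ) (t : Tri n) : Tri n := fun r i =>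
  if hu : 2 ≤ d ∧ r.val + 2 = d ∧ r.val + 1 < n then
    -- row d-1: swap with the entry diagonally below, else convert to a 𝒱-symbol
    let tk := rankOf t (r.val + 1)
    match t r i with
    | .x j =>
        (match t ⟨r.val + 1, hu.2.2⟩ ⟨i.val, by have := i.isLt; simp only [Fin.val_mk]; omega⟩ with
          | .b j' k => if j' = j then .b j' k
              else if h2 : j.val + tk < n then .a j ⟨j.val + tk, h2⟩ else .x j
          | _ => if h2 : j.val + tk < n then .a j ⟨j.val + tk, h2⟩ else .x j)
    | .y k =>
        (match t ⟨r.val + 1, hu.2.2⟩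
            ⟨i.val + 1, by have := i.isLt; simp only [Fin.val_mk]; omega⟩ with
          | .a j k' => if k' = k then .a j k'
              else if h2 : tk ≤ k.val then .b ⟨k.val - tk, by have := k.isLt; omega⟩ k
              else .y k
          | _ => if h2 : tk ≤ k.val then .b ⟨k.val - tk, by have := k.isLt; omega⟩ k
              else .y k)
    | s => s
  else if hl : r.val + 1 = d then
    -- row d: swap with the entry diagonally above, else convert to an 𝒳-symbol
    match t r i with
    | .b j k =>
        if hi : i.val < r.val then
          (if t ⟨r.val - 1, by have := r.isLt; omega⟩
              ⟨i.val, by simp only [Fin.val_mk]; omega⟩ = .x j then .x j else .y k)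
        else .y k
    | .a j k =>
        if hi : 1 ≤ i.val then
          (if t ⟨r.val - 1, by have := r.isLt; omega⟩
              ⟨i.val - 1, by have := i.isLt; simp only [Fin.val_mk]; omega⟩ = .y k
           then .y k else .x j)
        else .x j
    | s => s
  else t r i

namespace Tri

variable [NeZero n]

/-- The entries of a triangle with natural number indices, and a junk value out of range. -/
def ent (t : Tri n) (r i : ℕ) : TSym n :=
  if h : r < n ∧ i < r + 1 then t ⟨r, h.1⟩ ⟨i, h.2⟩ else .num 0

lemma ent_eq (t : Tri n) {r i : ℕ} (hr : r < n) (hi : i < r + 1) :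
    t.ent r i = t ⟨r, hr⟩ ⟨i, hi⟩ := dif_pos ⟨hr, hi⟩

/-- The entry diagonally above right of the `i`-th entry of row `r`, if any. -/
def aboveRight (t : Tri n) (r i : ℕ) : TSym n :=
  if i < r then t.ent (r - 1) i else .num 0

/-- The entry diagonally above left of the `i`-th entry of row `r`, if any. -/
def aboveLeft (t : Tri n) (r i : ℕ) : TSym n :=
  if 1 ≤ i then t.ent (r - 1) (i - 1) else .num 0

end Tri

namespace TSym

/-- The condition on an arrangement with `v` (in a row of rank `k`) directly above the
consecutive entries `u`, `w` (in a row of rank `m`). -/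
def Arrangement (m k : ℕ) (u v w : TSym n) : Prop :=
  (u.lval m ≤ v.lval k) ∧ ((∃ j, u = .y j) → u.lval m < v.lval k) ∧
    (v.rval k ≤ w.rval m) ∧ ((∃ j, w = .x j) → v.rval k < w.rval m) ∧
    (u.lval m < w.lval m)

/-- The new value of an entry `u` of the upper row under lowering, where `wl` and `wr` are the
entries diagonally below left and below right. -/
def lowerUpper (k : ℕ) (u wl wr : TSym n) : TSym n :=
  match u with
  | .x j =>
      if ∃ l, wl = .b j l ∧ l.val = j.val + k then wl
      else if h : j.val + k < n then .a j ⟨j.val + k, h⟩ else u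
  | .y l =>
      if ∃ j, wr = .a j l ∧ l.val = j.val + k then wr
      else if k ≤ l.val then .b ⟨l.val - k, by have := l.isLt; omega⟩ l else u
  | u => u

/-- The new value of an entry `w` of the lower row under lowering, where `ul` and `ur` are the
entries diagonally above left and above right. -/
def lowerLower (w ul ur : TSym n) : TSym n :=
  match w with
  | .b j l => if ur = .x j then .x j else .y l
  | .a j l => if ul = .y l then .y l else .x j
  | w => w

lemma weight_ne_zero (s : TSym n) : s.weight ≠ 0 := by
  cases s <;> simp [weight, MvPolynomial.X_ne_zero]

lemma rval_of_isX {s : TSym n} (h : s.isX) (k : ℕ) : s.rval k = s.lval k + k := by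
  cases s <;> simp_all [isX, rval, lval]

lemma rval_of_isV {s : TSym n} {k : ℕ} (h : s.isV k) (m : ℕ) : s.rval m = s.lval m + k := by
  cases s <;> simp_all [isV, rval, lval] <;> ring

lemma isV.not_isX {s : TSym n} {k : ℕ} (h : s.isV k) : ¬ s.isX := by
  cases s <;> simp_all [isV, isX]

lemma isV.wf {s : TSym n} {k : ℕ} (h : s.isV k) : s.wf := by
  cases s <;> simp_all [isV, TSym.wf, Fin.lt_def]

lemma isX.wf {s : TSym n} (h : s.isX) : s.wf := by
  cases s <;> simp_all [isX, TSym.wf]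

lemma one_le_lval_of_isV {s : TSym n} {k : ℕ} (h : s.isV k) (m : ℕ) : 1 ≤ s.lval m := by
  cases s <;> simp_all [isV, lval]

lemma rval_le_of_isV {s : TSym n} {k : ℕ} (h : s.isV k) (m : ℕ) : s.rval m ≤ n := by
  cases s <;> simp_all [isV, rval] <;> omega

lemma isX_lowerLower {w : TSym n} {k : ℕ} (h : w.isV k) (ul ur : TSym n) :
    (lowerLower w ul ur).isX := by
  cases w <;> simp_all [isV, lowerLower] <;> split_ifs <;> simp [isX]

lemma lval_lowerLower {w : TSym n} {k : ℕ} (h : w.isV k) (ul ur : TSym n) :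
    (lowerLower w ul ur).lval k = w.lval k := by
  cases w <;> simp_all [isV, lowerLower] <;> split_ifs <;> simp [lval, h.1] <;> ring

lemma rval_lowerLower {w : TSym n} {k : ℕ} (h : w.isV k) (ul ur : TSym n) :
    (lowerLower w ul ur).rval k = w.rval k := by
  rw [rval_of_isX (isX_lowerLower h ul ur), lval_lowerLower h, rval_of_isV h]

/-- The bounds which make lowering convert an `𝒳`-symbol to a `𝒱`-symbol. -/
def Bounded (k : ℕ) (u : TSym n) : Prop :=
  1 ≤ u.lval (k + 1) ∧ u.rval (k + 1) ≤ n

lemma isV_lowerUpper {u : TSym n} {k : ℕ} (hk : 0 < k) (hu : u.isX) (hb : u.Bounded k)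
    (wl wr : TSym n) : (lowerUpper k u wl wr).isV k := by
  cases u with
  | x j =>
    have h : j.val + k < n := by simp [Bounded, lval, rval] at hb; omega
    simp only [lowerUpper]
    split_ifs with h'
    · obtain ⟨l, rfl, hl⟩ := h'
      exact ⟨hl, hk⟩
    · exact ⟨rfl, hk⟩
  | y l =>
    have h : k ≤ l.val := by simp [Bounded, lval, rval] at hb; omega
    simp only [lowerUpper]
    split_ifs with h'
    · obtain ⟨j, rfl, hl⟩ := h'
      exact ⟨hl, hk⟩
    · exact ⟨by simp; omega, hk⟩
  | _ => simp [isX] at hu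

lemma lval_lowerUpper_x {j : Fin n} {k : ℕ} (hb : (x j : TSym n).Bounded k)
    (wl wr : TSym n) (m : ℕ) : (lowerUpper k (x j) wl wr).lval m = j.val + 1 := by
  have h : j.val + k < n := by simp [Bounded, lval, rval] at hb; omega
  simp only [lowerUpper]
  split_ifs with h'
  · obtain ⟨l, rfl, hl⟩ := h'
    simp [lval]
  · simp [lval]

lemma lval_lowerUpper_y {l : Fin n} {k : ℕ} (hb : (y l : TSym n).Bounded k)
    (wl wr : TSym n) (m : ℕ) : (lowerUpper k (y l) wl wr).lval m = l.val + 1 - k := by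
  have h : k ≤ l.val := by simp [Bounded, lval, rval] at hb; omega
  simp only [lowerUpper]
  split_ifs with h'
  · obtain ⟨j, rfl, hl⟩ := h'
    simp [lval, hl]
    ring
  · simp [lval]
    omega

lemma lval_x (j : Fin n) (k : ℕ) : (x j).lval k = (j.val : ℤ) + 1 := rfl

lemma lval_y (l : Fin n) (k : ℕ) : (y l).lval k = (l.val : ℤ) + 1 - k := rfl

lemma rval_x (j : Fin n) (k : ℕ) : (x j).rval k = (j.val : ℤ) + 1 + k := rfl

lemma rval_y (l : Fin n) (k : ℕ) : (y l).rval k = (l.val : ℤ) + 1 := rfl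

/-- A `y` followed by an `x` whose left value is larger by one leaves no room for an entry above
them. -/
lemma not_arrangement_y_x {j l : Fin n} {k : ℕ} (h : l.val = j.val + k) {v : TSym n}
    (hv : v.isX ∨ v.isV (k + 1)) : ¬ Arrangement (k + 1) (k + 1) (y l) v (x j) := by
  rintro ⟨-, h1, -, h2, -⟩
  have h1 := h1 ⟨_, rfl⟩
  have h2 := h2 ⟨_, rfl⟩
  have h3 : v.rval (k + 1) = v.lval (k + 1) + (k + 1 : ℕ) :=
    hv.elim (fun h => rval_of_isX h _) (fun h => rval_of_isV h _)
  rw [h3] at h2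
  generalize v.lval (k + 1) = a at h1 h2
  simp only [lval_y, rval_x] at h1 h2
  push_cast at h1 h2
  omega

lemma rval_lowerUpper {u : TSym n} {k : ℕ} (hk : 0 < k) (hu : u.isX) (hb : u.Bounded k)
    (wl wr : TSym n) (m : ℕ) :
    (lowerUpper k u wl wr).rval m = (lowerUpper k u wl wr).lval m + k :=
  rval_of_isV (isV_lowerUpper hk hu hb wl wr) m

lemma Arrangement.apex_lowerLower {m k : ℕ} {u w u' : TSym n} (h : Arrangement m k u w u')
    (hw : w.isV k) (ul ur : TSym n) : Arrangement m k u (lowerLower w ul ur) u' := by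
  simpa only [Arrangement, lval_lowerLower hw, rval_lowerLower hw] using h

lemma Arrangement.base_lowerUpper {k : ℕ} {u v u' : TSym n} (h : Arrangement (k + 1) (k + 1) u v u')
    (hk : 0 < k) (hu : u.isX) (hu' : u'.isX) (hb : u.Bounded k) (hb' : u'.Bounded k)
    (hv : v.isX ∨ v.isV (k + 1)) (wl wr wl' wr' : TSym n) :
    Arrangement k (k + 1) (lowerUpper k u wl wr) v (lowerUpper k u' wl' wr') := by
  have hV := isV_lowerUpper hk hu hb wl wr
  have hV' := isV_lowerUpper hk hu' hb' wl' wr'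
  have hyx := fun j l hjl => @not_arrangement_y_x n j l k hjl v hv
  refine ⟨?_, ?_, ?_, ?_, ?_⟩
  · obtain ⟨h1, h2, -, -, -⟩ := h
    cases u with
    | x j =>
      rw [lval_lowerUpper_x hb]
      exact h1
    | y l =>
      have h2 := h2 ⟨_, rfl⟩
      generalize v.lval (k + 1) = a at h2
      rw [lval_lowerUpper_y hb]
      simp only [lval_y] at h2
      push_cast at h2
      omega
    | _ => simp [isX] at hu
  · rintro ⟨j, hj⟩
    rw [hj] at hV
    exact hV.elim
  · obtain ⟨-, -, h1, h2, -⟩ := h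
    rw [rval_lowerUpper hk hu' hb']
    generalize v.rval (k + 1) = a at h1 h2
    cases u' with
    | x j =>
      have h2 := h2 ⟨_, rfl⟩
      rw [lval_lowerUpper_x hb']
      simp only [rval_x] at h2
      push_cast at h2
      omega
    | y l =>
      rw [lval_lowerUpper_y hb']
      simp only [rval_y] at h1
      omega
    | _ => simp [isX] at hu'
  · rintro ⟨j, hj⟩
    rw [hj] at hV'
    exact hV'.elim
  · have h5 := h.2.2.2.2
    cases u with
    | x j =>
      cases u' with
      | x j' =>
        rw [lval_lowerUpper_x hb, lval_lowerUpper_x hb']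
        exact h5
      | y l' =>
        rw [lval_lowerUpper_x hb, lval_lowerUpper_y hb']
        simp only [lval_x, lval_y] at h5
        push_cast at h5
        omega
      | _ => simp [isX] at hu'
    | y l =>
      cases u' with
      | x j' =>
        have hne : l.val ≠ j'.val + k := fun e => hyx j' l e h
        rw [lval_lowerUpper_y hb, lval_lowerUpper_x hb']
        simp only [lval_x, lval_y] at h5
        push_cast at h5
        omega
      | y l' =>
        rw [lval_lowerUpper_y hb, lval_lowerUpper_y hb']
        simp only [lval_y] at h5
        push_cast at h5
        omega
      | _ => simp [isX] at hu'
    | _ => simp [isX] at hu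

lemma eq_of_lowerLower_eq_y {w ul ur : TSym n} {l : Fin n} {k : ℕ} (hw : w.isV k)
    (h : lowerLower w ul ur = .y l) :
    (∃ j, w = .b j l ∧ ur ≠ .x j) ∨ (∃ j, w = .a j l ∧ ul = .y l) := by
  cases w <;> simp_all [lowerLower, isV] <;> split_ifs at h <;> simp_all

lemma eq_of_lowerLower_eq_x {w ul ur : TSym n} {j : Fin n} {k : ℕ} (hw : w.isV k)
    (h : lowerLower w ul ur = .x j) :
    (∃ l, w = .b j l ∧ ur = .x j) ∨ (∃ l, w = .a j l ∧ ul ≠ .y l) := by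
  cases w <;> simp_all [lowerLower, isV] <;> split_ifs at h <;> simp_all

lemma Arrangement.bounded {k : ℕ} {w u w' : TSym n} (h : Arrangement k (k + 1) w u w')
    (hw : w.isV k) (hw' : w'.isV k) : u.Bounded k :=
  ⟨(one_le_lval_of_isV hw k).trans h.1, h.2.2.1.trans (rval_le_of_isV hw' k)⟩

lemma Arrangement.lower {k : ℕ} {w u w' : TSym n} (h : Arrangement k (k + 1) w u w')
    (hk : 0 < k) (hw : w.isV k) (hw' : w'.isV k) (hu : u.isX) {ul ur : TSym n}
    (hl : ∀ j l : Fin n, l.val = j.val + k → ul = .y l → u ≠ .x j)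
    (hr : ∀ j l : Fin n, l.val = j.val + k → u = .y l → ur ≠ .x j) :
    Arrangement k k (lowerLower w ul u) (lowerUpper k u w w') (lowerLower w' u ur) := by
  have hb := h.bounded hw hw'
  unfold Arrangement
  simp only [lval_lowerLower hw, lval_lowerLower hw', rval_lowerLower hw',
    rval_lowerUpper hk hu hb]
  obtain ⟨h1, -, h3, -, h5⟩ := h
  cases u with
  | x j =>
    simp only [lval_lowerUpper_x hb]
    simp only [lval_x, rval_x] at h1 h3
    push_cast at h3
    refine ⟨h1, ?_, by omega, fun _ => by omega, h5⟩
    rintro ⟨l, hl'⟩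
    refine lt_of_le_of_ne h1 fun e => ?_
    rcases eq_of_lowerLower_eq_y hw hl' with ⟨i, rfl, hi⟩ | ⟨i, rfl, hi⟩
    · simp only [lval] at e
      exact hi (congrArg _ (Fin.ext (by omega)))
    · simp only [lval] at e
      exact hl j l (by have := hw.1; omega) hi rfl
  | y l =>
    simp only [lval_lowerUpper_y hb]
    simp only [lval_y, rval_y] at h1 h3
    push_cast at h1
    refine ⟨by omega, fun _ => by omega, by omega, ?_, h5⟩
    rintro ⟨j, hj⟩
    suffices w'.rval k ≠ l.val + 1 by omega
    intro e
    rcases eq_of_lowerLower_eq_x hw' hj with ⟨i, rfl, hi⟩ | ⟨i, rfl, hi⟩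
    · simp only [rval] at e
      exact hr j l (by have := hw'.1; omega) rfl hi
    · simp only [rval] at e
      exact hi (congrArg _ (Fin.ext (by omega)))
  | _ => simp [isX] at hu

end TSym

lemma lower_apply_of_ne (t : Tri n) {d : ℕ} (r : Fin n) (hr : r.val + 1 ≠ d)
    (hr' : r.val + 2 ≠ d) : Lower d t r = t r := by
  funext i
  simp [Lower, hr, hr']

namespace Tri

variable [NeZero n]

lemma ent_lower_of_ne (t : Tri n) {d r : ℕ} (hr : r + 1 ≠ d) (hr' : r + 2 ≠ d) (i : ℕ) :
    ent (Lower d t) r i = t.ent r i := by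
  unfold ent
  split_ifs with h
  · rw [lower_apply_of_ne t ⟨r, h.1⟩ hr hr']
  · rfl

lemma ent_lower_lower (t : Tri n) {e i : ℕ} (he : e < n) (hi : i ≤ e) :
    ent (Lower (e + 1) t) e i =
      (t.ent e i).lowerLower (t.aboveLeft e i) (t.aboveRight e i) := by
  have hi' : i < e + 1 := by omega
  have h1 : aboveRight t e i = if h : i < e then
      t ⟨e - 1, by omega⟩ ⟨i, by simp only []; omega⟩ else .num 0 := by
    unfold aboveRight
    split_ifs with h
    · exact ent_eq t _ _
    · rfl
  have h2 : aboveLeft t e i = if h : 1 ≤ i then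
      t ⟨e - 1, by omega⟩ ⟨i - 1, by simp only []; omega⟩ else .num 0 := by
    unfold aboveLeft
    split_ifs with h
    · exact ent_eq t _ _
    · rfl
  rw [ent_eq _ he hi', ent_eq _ he hi', h1, h2]
  simp only [Lower, TSym.lowerLower]
  rw [dif_neg (show ¬ (2 ≤ e + 1 ∧ e + 2 = e + 1 ∧ e + 1 < n) by omega), dif_pos trivial]
  cases t ⟨e, he⟩ ⟨i, hi'⟩ <;> simp only <;> split_ifs <;> simp_all

lemma ent_lower_upper (t : Tri n) {e i : ℕ} (he : e + 1 < n) (hi : i ≤ e)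
    (hw : (t.ent (e + 1) i).isV (rankOf t (e + 1)))
    (hw' : (t.ent (e + 1) (i + 1)).isV (rankOf t (e + 1))) :
    ent (Lower (e + 2) t) e i =
      (t.ent e i).lowerUpper (rankOf t (e + 1)) (t.ent (e + 1) i) (t.ent (e + 1) (i + 1)) := by
  have hi' : i < e + 1 := by omega
  have hi₁ : i < e + 1 + 1 := by omega
  have hi₂ : i + 1 < e + 1 + 1 := by omega
  rw [ent_eq _ he hi₁] at hw ⊢
  rw [ent_eq _ he hi₂] at hw' ⊢
  have he' : e < n := by omega
  rw [ent_eq _ he' hi', ent_eq _ he' hi']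
  simp only [Lower, TSym.lowerUpper]
  rw [dif_pos ⟨by omega, trivial, he⟩]
  cases t ⟨e, by omega⟩ ⟨i, hi'⟩ with
  | x j =>
    simp only
    generalize t ⟨e + 1, he⟩ ⟨i, hi₁⟩ = w at hw
    cases w <;> simp_all [TSym.isV] <;> grind
  | y l =>
    simp only
    generalize t ⟨e + 1, he⟩ ⟨i + 1, hi₂⟩ = w at hw'
    cases w <;> simp_all [TSym.isV] <;> grind
  | _ => rfl

lemma monoProps_iff (t : Tri n) (rk : ℕ → ℕ) :
    MonoProps t rk ↔ ∀ r p : ℕ, r + 1 < n → p ≤ r →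
      TSym.Arrangement (rk (r + 2)) (rk (r + 1)) (t.ent (r + 1) p) (t.ent r p)
        (t.ent (r + 1) (p + 1)) := by
  constructor
  · intro h r p hr hp
    rw [ent_eq _ hr (by omega), ent_eq _ hr (by omega), ent_eq _ (by omega) (by omega)]
    exact h ⟨r + 1, hr⟩ (by simp) p (by simp; omega)
  · rintro h ⟨r, hr⟩ h1 p hp
    obtain ⟨r, rfl⟩ : ∃ s, r = s + 1 := ⟨r - 1, by simp at h1; omega⟩
    have := h r p hr (by simp at hp; omega)
    rwa [ent_eq _ hr (by simp at hp; omega), ent_eq _ hr (by simp at hp; omega),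
      ent_eq _ (by omega) (by simp at hp; omega)] at this

lemma isXRow_iff (t : Tri n) {r : ℕ} (hr : r < n) :
    IsXRow t ⟨r, hr⟩ ↔ ∀ i ≤ r, (t.ent r i).isX := by
  constructor
  · intro h i hi
    rw [ent_eq _ hr (by omega)]
    exact h _
  · rintro h ⟨i, hi⟩
    have := h i (Nat.le_of_lt_succ hi)
    rwa [ent_eq _ hr hi] at this

lemma isVRowOf_iff (t : Tri n) {r k : ℕ} (hr : r < n) :
    IsVRowOf t ⟨r, hr⟩ k ↔ ∀ i ≤ r, (t.ent r i).isV k := by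
  constructor
  · intro h i hi
    rw [ent_eq _ hr (by omega)]
    exact h _
  · rintro h ⟨i, hi⟩
    have := h i (Nat.le_of_lt_succ hi)
    rwa [ent_eq _ hr hi] at this

lemma weight_eq_prod (t : Tri n) :
    weight t = ∏ r ∈ range (n - 1), ∏ i ∈ range (r + 1), (t.ent r i).weight := by
  let f (r : ℕ) := if r < n - 1 then ∏ i ∈ range (r + 1), (t.ent r i).weight else 1
  have h : weight t = ∏ r : Fin n, f r := by
    refine prod_congr rfl fun r _ => ?_
    simp only [f]
    split_ifs
    · rw [← Fin.prod_univ_eq_prod_range (fun i => (t.ent r i).weight)]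
      exact prod_congr rfl fun i _ => by rw [ent_eq t r.2 i.2]
    · rfl
  rw [h, Fin.prod_univ_eq_prod_range f, prod_ite, prod_const_one, mul_one]
  refine prod_congr ?_ fun _ _ => rfl
  ext r
  simp only [mem_filter, mem_range]
  omega

end Tri

namespace TSym

/-- Lowering swaps the upper entry `u` with the entry `w` diagonally below left. -/
def SwapsBelowLeft (u w : TSym n) : Prop := ∃ j l, u = .x j ∧ w = .b j l

/-- Lowering swaps the upper entry `u` with the entry `w` diagonally below right. -/
def SwapsBelowRight (u w : TSym n) : Prop := ∃ j l, u = .y l ∧ w = .a j l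

/-- The weight of `s` if `p` holds, and `1` otherwise. -/
noncomputable def weightIf (p : Prop) (s : TSym n) : MvPolynomial (Fin n ⊕ Fin n) ℤ :=
  if p then s.weight else 1

lemma weightIf_ne_zero (p : Prop) (s : TSym n) : weightIf p s ≠ 0 := by
  unfold weightIf
  split_ifs
  · exact weight_ne_zero s
  · exact one_ne_zero

lemma weight_lowerUpper {u wl wr : TSym n} {k : ℕ} (hu : u.isX) (hb : u.Bounded k)
    (hl : wl.isV k) (hr : wr.isV k) :
    (lowerUpper k u wl wr).weight *
        (weightIf (SwapsBelowLeft u wl) u * weightIf (SwapsBelowRight u wr) u) =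
      u.weight * (weightIf (SwapsBelowLeft u wl) wl * weightIf (SwapsBelowRight u wr) wr) := by
  cases u with
  | x j =>
    have h : j.val + k < n := by simp [Bounded, lval, rval] at hb; omega
    have hR : ¬ SwapsBelowRight (x j) wr := by simp [SwapsBelowRight]
    by_cases hL : SwapsBelowLeft (x j) wl
    · obtain ⟨i, l, hi, rfl⟩ := hL
      obtain rfl : j = i := by simpa using hi
      have hL : SwapsBelowLeft (x j) (b j l) := ⟨j, l, rfl, rfl⟩
      have hk : l.val = j.val + k := hl.1
      simp [weightIf, hL, hR, lowerUpper, hk, mul_comm]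
    · have hL' : ¬ ∃ l, wl = .b j l ∧ l.val = j.val + k :=
        fun ⟨l, h, _⟩ => hL ⟨j, l, rfl, h⟩
      simp [weightIf, hL, hR, lowerUpper, hL', h, weight]
  | y l =>
    have h : k ≤ l.val := by simp [Bounded, lval, rval] at hb; omega
    have hL : ¬ SwapsBelowLeft (y l) wl := by simp [SwapsBelowLeft]
    by_cases hR : SwapsBelowRight (y l) wr
    · obtain ⟨j, i, hi, rfl⟩ := hR
      obtain rfl : l = i := by simpa using hi
      have hR : SwapsBelowRight (y l) (a j l) := ⟨j, l, rfl, rfl⟩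
      have hk : l.val = j.val + k := hr.1
      simp [weightIf, hL, hR, lowerUpper, hk, mul_comm]
    · have hR' : ¬ ∃ j, wr = .a j l ∧ l.val = j.val + k :=
        fun ⟨j, h, _⟩ => hR ⟨j, l, rfl, h⟩
      simp [weightIf, hL, hR, lowerUpper, hR', h, weight]
  | _ => simp [isX] at hu

lemma weight_lowerLower {w ul ur : TSym n} {k : ℕ} (hw : w.isV k) :
    (lowerLower w ul ur).weight *
        (weightIf (SwapsBelowLeft ur w) w * weightIf (SwapsBelowRight ul w) w) =
      w.weight * (weightIf (SwapsBelowLeft ur w) ur * weightIf (SwapsBelowRight ul w) ul) := by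
  cases w with
  | a j l =>
    by_cases h : ul = .y l
    · subst h
      simp [weightIf, SwapsBelowLeft, SwapsBelowRight, lowerLower, mul_comm]
    · simp [weightIf, SwapsBelowLeft, SwapsBelowRight, lowerLower, h, weight]
  | b j l =>
    by_cases h : ur = .x j
    · subst h
      simp [weightIf, SwapsBelowLeft, SwapsBelowRight, lowerLower, mul_comm]
    · simp [weightIf, SwapsBelowLeft, SwapsBelowRight, lowerLower, h, weight]
  | _ => exact hw.elim

lemma prod_weight_lower {e k : ℕ} {u w ul ur : ℕ → TSym n} (hu : ∀ i < e, (u i).isX)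
    (hb : ∀ i < e, (u i).Bounded k) (hw : ∀ i ≤ e, (w i).isV k)
    (hl : ∀ i < e, ul (i + 1) = u i) (hl₀ : ¬ (ul 0).isX)
    (hr : ∀ i < e, ur i = u i) (hr₀ : ¬ (ur e).isX) :
    (∏ i ∈ range e, (lowerUpper k (u i) (w i) (w (i + 1))).weight) *
        ∏ i ∈ range (e + 1), (lowerLower (w i) (ul i) (ur i)).weight =
      (∏ i ∈ range e, (u i).weight) * ∏ i ∈ range (e + 1), (w i).weight := by
  have hR : ¬ SwapsBelowLeft (ur e) (w e) := by
    rintro ⟨j, l, h, -⟩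
    simp [h, isX] at hr₀
  have hL : ¬ SwapsBelowRight (ul 0) (w 0) := by
    rintro ⟨j, l, h, -⟩
    simp [h, isX] at hl₀
  have hU := prod_congr rfl fun i (hi : i ∈ range e) =>
    have hi := mem_range.1 hi
    weight_lowerUpper (hu i hi) (hb i hi) (hw i hi.le) (hw (i + 1) hi)
  have hW := prod_congr rfl fun i (hi : i ∈ range (e + 1)) =>
    weight_lowerLower (ul := ul i) (ur := ur i) (hw i (Nat.lt_succ_iff.1 (mem_range.1 hi)))
  have hA (f : TSym n → TSym n → TSym n) :
      ∏ i ∈ range (e + 1), weightIf (SwapsBelowLeft (ur i) (w i)) (f (ur i) (w i)) =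
        ∏ i ∈ range e, weightIf (SwapsBelowLeft (u i) (w i)) (f (u i) (w i)) := by
    rw [prod_range_succ, weightIf, if_neg hR, mul_one]
    exact prod_congr rfl fun i hi => by rw [hr i (mem_range.1 hi)]
  have hB (f : TSym n → TSym n → TSym n) :
      ∏ i ∈ range (e + 1), weightIf (SwapsBelowRight (ul i) (w i)) (f (ul i) (w i)) =
        ∏ i ∈ range e,
          weightIf (SwapsBelowRight (u i) (w (i + 1))) (f (u i) (w (i + 1))) := by
    rw [prod_range_succ', weightIf, if_neg hL, mul_one]
    exact prod_congr rfl fun i hi => by rw [hl i (mem_range.1 hi)]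
  simp only [prod_mul_distrib] at hU hW
  rw [hA fun _ w => w, hA fun u _ => u, hB fun _ w => w, hB fun u _ => u] at hW
  have hne (p : ℕ → Prop) (s : ℕ → TSym n) : ∏ i ∈ range e, weightIf (p i) (s i) ≠ 0 :=
    prod_ne_zero_iff.2 fun _ _ => weightIf_ne_zero _ _
  refine mul_right_cancel₀ (mul_ne_zero
    (mul_ne_zero (hne (fun i => SwapsBelowLeft (u i) (w i)) u)
      (hne (fun i => SwapsBelowRight (u i) (w (i + 1))) u))
    (mul_ne_zero (hne (fun i => SwapsBelowLeft (u i) (w i)) w)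
      (hne (fun i => SwapsBelowRight (u i) (w (i + 1))) fun i => w (i + 1)))) ?_
  rw [mul_mul_mul_comm, hU, hW]
  ring

end TSym

lemma rankOf_eq_succ (t : Tri n) {r : ℕ} (hr : r + 1 < n) :
    rankOf t r = rankOf t (r + 1) + if IsVRow t ⟨r + 1, hr⟩ then 1 else 0 := by
  have h (s : Fin n) : r < s.val ↔ s = ⟨r + 1, hr⟩ ∨ r + 1 < s.val := by
    rw [Fin.ext_iff]
    simp only
    omega
  unfold rankOf
  rw [add_assoc]
  congr 1
  split_ifs with hv
  · rw [← card_insert_of_notMem (a := (⟨r + 1, hr⟩ : Fin n)) (by simp)]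
    congr 1
    ext s
    simp only [mem_filter, mem_univ, true_and, mem_insert, h s]
    constructor
    · rintro ⟨rfl | h1, h2⟩ <;> simp [*]
    · rintro (rfl | ⟨h1, h2⟩) <;> simp [*]
  · rw [add_zero]
    congr 1
    ext s
    simp only [mem_filter, mem_univ, true_and, h s]
    constructor
    · rintro ⟨rfl | h1, h2⟩
      · exact absurd h2 hv
      · exact ⟨h1, h2⟩
    · exact fun h => ⟨Or.inr h.1, h.2⟩

lemma BottomOK.not_isVRow {t : Tri n} (hb : BottomOK t) {r : Fin n} (hr : r.val = n - 1) :
    ¬ IsVRow t r := by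
  rintro ⟨k, hk⟩
  have := hk 0
  rw [hb r hr] at this
  exact this

lemma IsXRow.not_isVRow {t : Tri n} {r : Fin n} (h : IsXRow t r) : ¬ IsVRow t r :=
  fun ⟨_, hk⟩ => (hk 0).not_isX (h 0)

lemma IsRanking.rankOf_eq {t : Tri n} {rk : ℕ → ℕ} (h : IsRanking t rk) (hb : BottomOK t) :
    ∀ m r : ℕ, r + m + 2 = n → rankOf t r = rk (r + 1) := by
  intro m
  induction m with
  | zero =>
    intro r hr
    have h1 : rk (n - 1) = 1 := h.2.1 (by omega)
    rw [show r + 1 = n - 1 by omega, h1, rankOf, Nat.add_eq_left, card_eq_zero,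
      filter_eq_empty_iff]
    rintro s - ⟨h2, h3⟩
    exact hb.not_isVRow (by omega) h3
  | succ m ih =>
    intro r hr
    rw [rankOf_eq_succ t (show r + 1 < n by omega), ih (r + 1) (by omega)]
    rcases h.2.2 ⟨r + 1, by omega⟩ (by simp only; omega) with ⟨h1, h2⟩ | ⟨h1, h2⟩
    · rw [if_neg h1.not_isVRow]
      exact h2.symm
    · rw [if_pos ⟨_, h1⟩]
      exact h2.symm

/-- A triangle with admissible ranking `rk` to which `L_{e+1}` can be applied. -/
structure IsLowerable [NeZero n] (t : Tri n) (rk : ℕ → ℕ) (e : ℕ) : Prop where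
  lt : e + 1 < n
  bottom : BottomOK t
  wellFormed : WellFormed t
  ranking : IsRanking t rk
  mono : MonoProps t rk
  isV : ∀ i ≤ e, (t.ent e i).isV (rk (e + 1))
  isX : ∀ f, f + 1 = e → ∀ i ≤ f, (t.ent f i).isX

namespace IsLowerable

variable [NeZero n] {t : Tri n} {rk : ℕ → ℕ} {e : ℕ}

lemma rank_pos (h : IsLowerable t rk e) : 0 < rk (e + 1) := by
  have := h.isV 0 e.zero_le
  revert this
  cases t.ent e 0 <;> simp +contextual [TSym.isV]

lemma rankOf_eq (h : IsLowerable t rk e) : rankOf t e = rk (e + 1) :=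
  h.ranking.rankOf_eq h.bottom (n - 2 - e) e (by have := h.lt; omega)

lemma rank_row (h : IsLowerable t rk e) : rk e = rk (e + 1) + 1 := by
  have he := h.lt
  rcases h.ranking.2.2 ⟨e, by omega⟩ (by simp only; omega) with ⟨h1, -⟩ | ⟨-, h2⟩
  · exact absurd ((t.isXRow_iff _).1 h1 0 e.zero_le) (h.isV 0 e.zero_le).not_isX
  · exact h2

lemma rank_above {f : ℕ} (h : IsLowerable t rk (f + 1)) : rk f = rk (f + 2) + 1 := by
  have he := h.lt
  rcases h.ranking.2.2 ⟨f, by omega⟩ (by simp only; omega) with ⟨-, h2⟩ | ⟨h1, -⟩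
  · exact h2.trans h.rank_row
  · exact absurd (h.isX f rfl 0 f.zero_le)
      ((t.isVRowOf_iff _).1 h1 0 f.zero_le).not_isX

lemma arrangement (h : IsLowerable t rk e) {r p : ℕ} (hr : r + 1 < n) (hp : p ≤ r) :
    TSym.Arrangement (rk (r + 2)) (rk (r + 1)) (t.ent (r + 1) p) (t.ent r p)
      (t.ent (r + 1) (p + 1)) :=
  (t.monoProps_iff rk).1 h.mono r p hr hp

lemma arrangement_middle {f p : ℕ} (h : IsLowerable t rk (f + 1)) (hp : p ≤ f) :
    TSym.Arrangement (rk (f + 2)) (rk (f + 2) + 1) (t.ent (f + 1) p) (t.ent f p)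
      (t.ent (f + 1) (p + 1)) := by
  have := h.arrangement (r := f) (by have := h.lt; omega) hp
  rwa [h.rank_row] at this

lemma bounded {f i : ℕ} (h : IsLowerable t rk (f + 1)) (hi : i ≤ f) :
    (t.ent f i).Bounded (rk (f + 2)) :=
  (h.arrangement_middle hi).bounded (h.isV i (by omega)) (h.isV (i + 1) (by omega))

lemma arrangement_top {g p : ℕ} (h : IsLowerable t rk (g + 2)) (hp : p ≤ g) :
    TSym.Arrangement (rk (g + 3) + 1) (rk (g + 3) + 1) (t.ent (g + 1) p) (t.ent g p)
      (t.ent (g + 1) (p + 1)) := by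
  have := h.arrangement (r := g) (by have := h.lt; omega) hp
  rwa [h.rank_row, h.rank_above] at this

lemma isX_or_isV {g p : ℕ} (h : IsLowerable t rk (g + 2)) (hp : p ≤ g) :
    (t.ent g p).isX ∨ (t.ent g p).isV (rk (g + 3) + 1) := by
  have he := h.lt
  rcases h.ranking.2.2 ⟨g, by omega⟩ (by simp only; omega) with ⟨h1, -⟩ | ⟨h1, -⟩
  · exact Or.inl ((t.isXRow_iff _).1 h1 p hp)
  · have := (t.isVRowOf_iff _).1 h1 p hp
    simp only at this
    rw [h.rank_above] at this
    exact Or.inr this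

lemma ne_x_of_eq_y {f p : ℕ} (h : IsLowerable t rk (f + 1)) (hp : p < f) {j l : Fin n}
    (hjl : l.val = j.val + rk (f + 2)) (hy : t.ent f p = .y l) : t.ent f (p + 1) ≠ .x j := by
  intro hx
  obtain ⟨g, rfl⟩ : ∃ g, f = g + 1 := ⟨f - 1, by omega⟩
  have hp : p ≤ g := by omega
  have := h.arrangement_top hp
  rw [hy, hx] at this
  exact TSym.not_arrangement_y_x hjl (h.isX_or_isV hp) this

lemma ent_lower_row (h : IsLowerable t rk e) {i : ℕ} (hi : i ≤ e) :
    Tri.ent (Lower (e + 1) t) e i =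
      (t.ent e i).lowerLower (t.aboveLeft e i) (t.aboveRight e i) :=
  t.ent_lower_lower (by have := h.lt; omega) hi

lemma ent_lower_above {f i : ℕ} (h : IsLowerable t rk (f + 1)) (hi : i ≤ f) :
    Tri.ent (Lower (f + 2) t) f i =
      (t.ent f i).lowerUpper (rk (f + 2)) (t.ent (f + 1) i) (t.ent (f + 1) (i + 1)) := by
  have hr := h.rankOf_eq
  have := t.ent_lower_upper (e := f) (i := i) (by have := h.lt; omega) hi
    (hr ▸ h.isV i (by omega)) (hr ▸ h.isV (i + 1) (by omega))
  rwa [hr] at this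

lemma isX_lower_row (h : IsLowerable t rk e) {i : ℕ} (hi : i ≤ e) :
    (Tri.ent (Lower (e + 1) t) e i).isX := by
  rw [h.ent_lower_row hi]
  exact TSym.isX_lowerLower (h.isV i hi) _ _

lemma isV_lower_above {f i : ℕ} (h : IsLowerable t rk (f + 1)) (hi : i ≤ f) :
    (Tri.ent (Lower (f + 2) t) f i).isV (rk (f + 2)) := by
  rw [h.ent_lower_above hi]
  exact TSym.isV_lowerUpper h.rank_pos (h.isX f rfl i hi) (h.bounded hi) _ _

lemma bottom_lower (h : IsLowerable t rk e) : BottomOK (Lower (e + 1) t) := by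
  have he := h.lt
  intro r hr i
  rw [lower_apply_of_ne t r (by omega) (by omega)]
  exact h.bottom r hr i

lemma wellFormed_lower (h : IsLowerable t rk e) : WellFormed (Lower (e + 1) t) := by
  rintro ⟨r, hr⟩ hr' ⟨i, hi⟩
  by_cases h1 : r = e
  · subst h1
    have := (h.isX_lower_row (Nat.le_of_lt_succ hi)).wf
    rwa [Tri.ent_eq _ hr hi] at this
  by_cases h2 : r + 1 = e
  · subst h2
    have := (h.isV_lower_above (Nat.le_of_lt_succ hi)).wf
    rwa [Tri.ent_eq _ hr hi] at this
  rw [lower_apply_of_ne t _ (by simp only; omega) (by simp only; omega)]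
  exact h.wellFormed _ hr' _

lemma ranking_lower (h : IsLowerable t rk e) :
    IsRanking (Lower (e + 1) t) (Function.update rk e (rk (e + 1))) := by
  have he := h.lt
  refine ⟨?_, fun hn => ?_, ?_⟩
  · rw [Function.update_of_ne (by omega)]
    exact h.ranking.1
  · rw [Function.update_of_ne (by omega)]
    exact h.ranking.2.1 hn
  rintro ⟨r, hr⟩ hr'
  by_cases h1 : r = e
  · subst h1
    refine Or.inl ⟨(Tri.isXRow_iff _ hr).2 fun i hi => h.isX_lower_row hi, ?_⟩
    simp
  by_cases h2 : r + 1 = e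
  · subst h2
    refine Or.inr ⟨(Tri.isVRowOf_iff _ hr).2 fun i hi => ?_, ?_⟩
    · simpa using h.isV_lower_above hi
    · simpa using h.rank_above
  have hrow := lower_apply_of_ne t (d := e + 1) ⟨r, hr⟩ (by simp only; omega)
    (by simp only; omega)
  simpa only [IsXRow, IsVRowOf, hrow, Function.update_of_ne h1, Function.update_of_ne h2]
    using h.ranking.2.2 ⟨r, hr⟩ hr'

lemma mono_lower (h : IsLowerable t rk e) :
    MonoProps (Lower (e + 1) t) (Function.update rk e (rk (e + 1))) := by
  rw [Tri.monoProps_iff]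
  intro r p hr hp
  by_cases h1 : r = e
  · subst h1
    rw [Function.update_of_ne (by omega), Function.update_of_ne (by omega),
      t.ent_lower_of_ne (r := r + 1) (by omega) (by omega),
      t.ent_lower_of_ne (r := r + 1) (by omega) (by omega), h.ent_lower_row hp]
    exact (h.arrangement hr hp).apex_lowerLower (h.isV p hp) _ _
  by_cases h2 : r + 1 = e
  · subst h2
    rw [Function.update_of_ne (by omega), Function.update_self, h.ent_lower_above hp,
      h.ent_lower_row (by omega), h.ent_lower_row (by omega)]
    have h3 : t.aboveLeft (r + 1) (p + 1) = t.ent r p := by simp [Tri.aboveLeft]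
    have h4 : t.aboveRight (r + 1) p = t.ent r p := by
      simp [Tri.aboveRight, Nat.lt_succ_of_le hp]
    rw [h3, h4]
    refine (h.arrangement_middle hp).lower h.rank_pos (h.isV p (by omega))
      (h.isV (p + 1) (by omega)) (h.isX r rfl p hp) ?_ ?_
    · intro j l hjl hy
      unfold Tri.aboveLeft at hy
      split_ifs at hy with hp'
      obtain ⟨q, rfl⟩ : ∃ q, p = q + 1 := ⟨p - 1, by omega⟩
      exact h.ne_x_of_eq_y (by omega) hjl hy
    · intro j l hjl hy hx
      unfold Tri.aboveRight at hx
      split_ifs at hx with hp'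
      exact h.ne_x_of_eq_y (by omega) hjl hy hx
  by_cases h3 : r + 2 = e
  · subst h3
    rw [Function.update_self, Function.update_of_ne (by omega), h.rank_above,
      t.ent_lower_of_ne (r := r) (by omega) (by omega), h.ent_lower_above (by omega),
      h.ent_lower_above (by omega)]
    exact (h.arrangement_top hp).base_lowerUpper h.rank_pos (h.isX _ rfl p (by omega))
      (h.isX _ rfl (p + 1) (by omega)) (h.bounded (by omega)) (h.bounded (by omega))
      (h.isX_or_isV hp) _ _ _ _
  rw [Function.update_of_ne h3, Function.update_of_ne h2,
    t.ent_lower_of_ne (by omega) (by omega), t.ent_lower_of_ne (by omega) (by omega),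
    t.ent_lower_of_ne (by omega) (by omega)]
  exact h.arrangement hr hp

lemma prod_weight_lower (h : IsLowerable t rk e) :
    ∏ r ∈ range (e + 1), ∏ i ∈ range (r + 1), (Tri.ent (Lower (e + 1) t) r i).weight =
      ∏ r ∈ range (e + 1), ∏ i ∈ range (r + 1), (t.ent r i).weight := by
  have key := TSym.prod_weight_lower (e := e) (k := rk (e + 1)) (u := t.ent (e - 1))
    (w := t.ent e) (ul := t.aboveLeft e) (ur := t.aboveRight e)
    (fun i hi => h.isX (e - 1) (by omega) i (by omega))
    (fun i hi => by
      obtain ⟨f, rfl⟩ : ∃ f, e = f + 1 := ⟨e - 1, by omega⟩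
      exact h.bounded (by omega))
    h.isV (fun i _ => by simp [Tri.aboveLeft]) (by simp [Tri.aboveLeft, TSym.isX])
    (fun i hi => by simp [Tri.aboveRight, hi]) (by simp [Tri.aboveRight, TSym.isX])
  have hrow : ∏ i ∈ range (e + 1), (Tri.ent (Lower (e + 1) t) e i).weight =
      ∏ i ∈ range (e + 1),
        ((t.ent e i).lowerLower (t.aboveLeft e i) (t.aboveRight e i)).weight :=
    prod_congr rfl fun i hi => by
      rw [h.ent_lower_row (Nat.lt_succ_iff.1 (mem_range.1 hi))]
  refine (prod_range_succ _ e).trans (Eq.trans ?_ (prod_range_succ _ e).symm)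
  rw [hrow]
  cases e with
  | zero => simpa using key
  | succ f =>
    have hrow' : ∏ i ∈ range (f + 1), (Tri.ent (Lower (f + 2) t) f i).weight =
        ∏ i ∈ range (f + 1), ((t.ent f i).lowerUpper (rk (f + 2)) (t.ent (f + 1) i)
          (t.ent (f + 1) (i + 1))).weight :=
      prod_congr rfl fun i hi => by
        rw [h.ent_lower_above (Nat.lt_succ_iff.1 (mem_range.1 hi))]
    refine (congrArg (· * _) (prod_range_succ _ f)).trans
      (Eq.trans ?_ (congrArg (· * _) (prod_range_succ _ f).symm))
    rw [hrow', mul_assoc, mul_assoc]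
    refine congrArg₂ (· * ·) (prod_congr rfl fun r hr => prod_congr rfl fun i _ => ?_) key
    have := mem_range.1 hr
    rw [t.ent_lower_of_ne (by omega) (by omega)]

lemma weight_lower (h : IsLowerable t rk e) : weight (Lower (e + 1) t) = weight t := by
  have he : e + 1 ≤ n - 1 := by have := h.lt; omega
  rw [Tri.weight_eq_prod, Tri.weight_eq_prod, ← prod_range_mul_prod_Ico _ he,
    ← prod_range_mul_prod_Ico _ he, h.prod_weight_lower]
  congr 1
  refine prod_congr rfl fun r hr => prod_congr rfl fun i _ => ?_
  have := mem_Ico.1 hr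
  rw [t.ent_lower_of_ne (by omega) (by omega)]

lemma rankOf_lower {f : ℕ} (h : IsLowerable t rk (f + 1)) :
    rankOf (Lower (f + 2) t) f = rankOf t (f + 1) := by
  rw [h.rankOf_eq, h.ranking_lower.rankOf_eq h.bottom_lower (n - 2 - f) f
    (by have := h.lt; omega), Function.update_self]

end IsLowerable

/-- Lowering preserves admissibility and weight, and lowers the rank of row `d-1`
from `t+1` to `t` (the rank of row `d`). -/
theorem stmt14 (n d : ℕ) (t : Tri n) (h1 : 1 ≤ d) (h2 : d < n)
    (hadm : IsAdmissible t)
    (hV : IsVRow t ⟨d - 1, by omega⟩)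
    (hX : ∀ _ : 2 ≤ d, IsXRow t ⟨d - 2, by omega⟩) :
    IsAdmissible (Lower d t) ∧ weight (Lower d t) = weight t ∧
      (2 ≤ d → rankOf (Lower d t) (d - 2) = rankOf t (d - 1)) := by
  obtain ⟨e, rfl⟩ : ∃ e, d = e + 1 := ⟨d - 1, by omega⟩
  have : NeZero n := ⟨by omega⟩
  obtain ⟨hb, hw, rk, hr, hm⟩ := hadm
  have h : IsLowerable t rk e := by
    refine ⟨h2, hb, hw, hr, hm, ?_, ?_⟩
    · rcases hr.2.2 ⟨e, by omega⟩ (by simp only; omega) with ⟨h3, -⟩ | ⟨h3, -⟩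
      · exact absurd hV h3.not_isVRow
      · exact (t.isVRowOf_iff _).1 h3
    · rintro f rfl
      exact (t.isXRow_iff _).1 (hX (by omega))
  refine ⟨⟨h.bottom_lower, h.wellFormed_lower, _, h.ranking_lower, h.mono_lower⟩,
    h.weight_lower, fun hd => ?_⟩
  obtain ⟨f, rfl⟩ : ∃ f, e = f + 1 := ⟨e - 1, by omega⟩
  exact h.rankOf_lower
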